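/- Assume q_0 has finite fourth moment. Then for every t > 0 and every x ∈ ℝ^d, ∂_t ∇_x² log q_t(x) = (2 λ_t²/σ_t⁴) I_d + (2 λ_t²/σ_t⁴ − 4 λ_t²/σ_t⁶) C_t(x) + (λ_t²/σ_t⁴) E_{t,x}[ (θ − m(t, x))(θ − m(t, x))^⊤ ( f_0(θ, x, t) − E_{t,x}[f_0(θ, x, t)] ) ], where f_0(θ, x, t) = (λ_t²/σ_t⁴) ‖θ‖₂² − ((λ_t + λ_t³)/σ_t⁴) ⟨x, θ⟩. -/

import Mathlib

open MeasureTheory ProbabilityTheory Real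
open scoped RealInnerProductSpace

noncomputable section

abbrev Vec (d : ℕ) := EuclideanSpace ℝ (Fin d)

def stdGaussian (d : ℕ) : Measure (Vec d) :=
  Measure.map (⇑(EuclideanSpace.equiv (Fin d) ℝ).symm)
    (Measure.pi fun _ : Fin d => gaussianReal 0 1)

/-- The law `q_u` of `e^{-u} θ + √(1 - e^{-2u}) g`, with `θ ~ q0` and `g ~ N(0, I_d)`
independent. -/
def forwardLaw {d : ℕ} (q0 : Measure (Vec d)) (u : ℝ) : Measure (Vec d) :=
  Measure.map (fun p : Vec d × Vec d =>
      Real.exp (-u) • p.1 + Real.sqrt (1 - Real.exp (-2*u)) • p.2)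
    (q0.prod (stdGaussian d))

/-- Gaussian weight `exp(-‖x - λ_t θ‖² / (2σ_t²))`. -/
def weight {d : ℕ} (t : ℝ) (x θ : Vec d) : ℝ :=
  Real.exp (-‖x - Real.exp (-t) • θ‖^2 / (2 * (1 - Real.exp (-2*t))))

/-- The conditional law `μ_{t,x}` of `θ` given `λ_t θ + σ_t g = x`:
`dμ_{t,x}(θ) = Z_{t,x}⁻¹ exp(-‖x - λ_t θ‖²/(2σ_t²)) dq0(θ)`. -/
def condMeasure {d : ℕ} (q0 : Measure (Vec d)) (t : ℝ) (x : Vec d) : Measure (Vec d) :=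
  (∫⁻ θ, ENNReal.ofReal (weight t x θ) ∂q0)⁻¹ •
    q0.withDensity fun θ => ENNReal.ofReal (weight t x θ)

/-- The conditional mean `m(t, x) = E_{t,x}[θ]`. -/
def condMean {d : ℕ} (q0 : Measure (Vec d)) (t : ℝ) (x : Vec d) : Vec d :=
  ∫ θ, θ ∂(condMeasure q0 t x)

/-- Partial derivative in the `i`-th coordinate direction. -/
def pd {d : ℕ} (i : Fin d) (f : Vec d → ℝ) (x : Vec d) : ℝ :=
  fderiv ℝ f x (EuclideanSpace.single i 1)

/-- The auxiliary function `f₀(θ, x, t) = (λ_t²/σ_t⁴)‖θ‖² - ((λ_t + λ_t³)/σ_t⁴)⟨x, θ⟩`. -/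
def f0 {d : ℕ} (t : ℝ) (x θ : Vec d) : ℝ :=
  Real.exp (-t)^2 / (1 - Real.exp (-2*t))^2 * ‖θ‖^2
    - (Real.exp (-t) + Real.exp (-t)^3) / (1 - Real.exp (-2*t))^2 * @inner ℝ _ _ x θ

/-- A finite product of real Gaussians of common nonzero variance has the product density. -/
lemma pi_gaussianReal_eq_withDensity {ι : Type*} [Fintype ι] (m : ι → ℝ) {v : NNReal}
    (hv : v ≠ 0) :
    Measure.pi (fun i => gaussianReal (m i) v)
      = volume.withDensity fun y => ENNReal.ofReal (∏ i, gaussianPDFReal (m i) v (y i)) := by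
  refine Measure.pi_eq fun s hs => ?_
  rw [withDensity_apply _ (MeasurableSet.univ_pi hs), volume_pi, Measure.restrict_pi_pi,
    ← ofReal_integral_eq_lintegral_ofReal, integral_fintype_prod_eq_prod,
    ENNReal.ofReal_prod_of_nonneg]
  · exact Finset.prod_congr rfl fun i _ => (gaussianReal_apply_eq_integral (m i) hv (s i)).symm
  · exact fun i _ => integral_nonneg fun y => gaussianPDFReal_nonneg _ _ _
  · exact Integrable.fintype_prod_dep fun i => (integrable_gaussianPDFReal (m i) v).restrict
  · exact ae_of_all _ fun y => Finset.prod_nonneg fun i _ => gaussianPDFReal_nonneg _ _ _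

lemma one_sub_exp_pos {u : ℝ} (hu : 0 < u) : 0 < 1 - Real.exp (-2 * u) := by
  have : Real.exp (-2 * u) < 1 := Real.exp_lt_one_iff.2 (by linarith)
  linarith

/-- The normalizing constant `(2πσ_u²)^{-d/2}` of the Gaussian transition density. -/
def gaussianNormalizer (d : ℕ) (u : ℝ) : ℝ :=
  (√(2 * π * (1 - Real.exp (-2 * u))))⁻¹ ^ d

lemma gaussianNormalizer_pos (d : ℕ) {u : ℝ} (hu : 0 < u) : 0 < gaussianNormalizer d u := by
  have := one_sub_exp_pos hu
  unfold gaussianNormalizer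
  positivity

lemma prod_gaussianPDFReal_eq {d : ℕ} {u : ℝ} (hu : 0 < u) (y θ : Vec d) :
    ∏ i, gaussianPDFReal (Real.exp (-u) * θ i) (1 - Real.exp (-2 * u)).toNNReal (y i)
      = gaussianNormalizer d u * weight u y θ := by
  have hs := one_sub_exp_pos hu
  simp only [gaussianPDFReal_def, Real.coe_toNNReal _ hs.le, Finset.prod_mul_distrib,
    Finset.prod_const, Finset.card_univ, Fintype.card_fin, gaussianNormalizer, weight,
    ← Real.exp_sum, EuclideanSpace.norm_sq_eq, Real.norm_eq_abs, sq_abs]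
  congr 2
  rw [← Finset.sum_div, ← Finset.sum_neg_distrib]
  simp

lemma measurable_weight_uncurry {d : ℕ} (u : ℝ) :
    Measurable fun p : Vec d × Vec d => weight u p.1 p.2 := by
  unfold weight
  fun_prop

lemma continuous_weight_left {d : ℕ} (u : ℝ) (θ : Vec d) :
    Continuous fun y : Vec d => weight u y θ := by
  unfold weight
  fun_prop

lemma continuous_weight_right {d : ℕ} (u : ℝ) (y : Vec d) :
    Continuous fun θ : Vec d => weight u y θ := by
  unfold weight
  fun_prop

lemma weight_pos {d : ℕ} (u : ℝ) (y θ : Vec d) : 0 < weight u y θ := Real.exp_pos _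

lemma weight_le_one {d : ℕ} {u : ℝ} (hu : 0 < u) (y θ : Vec d) : weight u y θ ≤ 1 := by
  have hs := one_sub_exp_pos hu
  refine Real.exp_le_one_iff.2 (div_nonpos_of_nonpos_of_nonneg ?_ (by positivity))
  exact neg_nonpos.2 (by positivity)

lemma integrable_weight {d : ℕ} (q0 : Measure (Vec d)) [IsFiniteMeasure q0] {u : ℝ} (hu : 0 < u)
    (y : Vec d) : Integrable (weight u y) q0 := by
  refine Integrable.of_bound (continuous_weight_right u y).aestronglyMeasurable 1
    (ae_of_all _ fun θ => ?_)
  rw [Real.norm_of_nonneg (weight_pos u y θ).le]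
  exact weight_le_one hu y θ

lemma continuous_integral_weight {d : ℕ} (q0 : Measure (Vec d)) [IsFiniteMeasure q0] {u : ℝ}
    (hu : 0 < u) : Continuous fun y => ∫ θ, weight u y θ ∂q0 := by
  refine continuous_of_dominated (bound := fun _ => 1)
    (fun y => (continuous_weight_right u y).aestronglyMeasurable)
    (fun y => ae_of_all _ fun θ => ?_) (integrable_const _)
    (ae_of_all _ fun θ => continuous_weight_left u θ)
  rw [Real.norm_of_nonneg (weight_pos u y θ).le]
  exact weight_le_one hu y θ

/-- The transition law of the Ornstein–Uhlenbeck step started from `θ`. -/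
lemma map_affine_stdGaussian {d : ℕ} {u : ℝ} (hu : 0 < u) (θ : Vec d) :
    Measure.map (fun g : Vec d => Real.exp (-u) • θ + √(1 - Real.exp (-2 * u)) • g)
        (_root_.stdGaussian d)
      = volume.withDensity fun y => ENNReal.ofReal (gaussianNormalizer d u * weight u y θ) := by
  have hs := one_sub_exp_pos hu
  set s := 1 - Real.exp (-2 * u)
  have hv : s.toNNReal ≠ 0 := by simpa using hs
  have hcoord (i : Fin d) : Measure.map (fun z : ℝ => Real.exp (-u) * θ i + √s * z)
      (gaussianReal 0 1) = gaussianReal (Real.exp (-u) * θ i) s.toNNReal := by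
    have h : (fun z : ℝ => Real.exp (-u) * θ i + √s * z)
        = (fun z => Real.exp (-u) * θ i + z) ∘ fun z => √s * z := rfl
    rw [h, ← Measure.map_map (by fun_prop) (by fun_prop), gaussianReal_map_const_mul,
      gaussianReal_map_const_add]
    congr 1
    · simp
    · ext
      simp [Real.sq_sqrt hs.le, hs.le]
  have hpi := Measure.pi_map_pi (μ := fun _ : Fin d => gaussianReal 0 1)
    (f := fun i z => Real.exp (-u) * θ i + √s * z)
    (hf := fun i => Measurable.aemeasurable (by fun_prop))
  simp only [hcoord] at hpi
  have hvol : (volume : Measure (Vec d))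
      = Measure.map (WithLp.toLp 2) (volume : Measure (Fin d → ℝ)) :=
    (PiLp.volume_preserving_toLp (Fin d)).map_eq.symm
  have hcomp : (fun g : Vec d => Real.exp (-u) • θ + √s • g) ∘ (EuclideanSpace.equiv (Fin d) ℝ).symm
      = WithLp.toLp 2 ∘ fun z i => Real.exp (-u) * θ i + √s * z i := by
    funext z
    ext i
    simp
  rw [_root_.stdGaussian, Measure.map_map (by fun_prop) (by fun_prop), hcomp,
    ← Measure.map_map (by fun_prop) (by fun_prop), hpi, pi_gaussianReal_eq_withDensity _ hv]
  ext A hA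
  rw [Measure.map_apply (by fun_prop) hA, withDensity_apply _ hA,
    withDensity_apply _ (WithLp.measurable_toLp 2 _ hA), hvol,
    setLIntegral_map hA _ (WithLp.measurable_toLp 2 _)]
  · exact lintegral_congr fun z => by rw [← prod_gaussianPDFReal_eq hu]
  · exact ((continuous_weight_left u θ).measurable.const_mul _).ennreal_ofReal

lemma forwardLaw_eq_withDensity {d : ℕ} (q0 : Measure (Vec d)) [IsProbabilityMeasure q0] {u : ℝ}
    (hu : 0 < u) :
    forwardLaw q0 u = volume.withDensity fun y =>
      ENNReal.ofReal (gaussianNormalizer d u * ∫ θ, weight u y θ ∂q0) := by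
  have hprob : IsProbabilityMeasure (_root_.stdGaussian d) :=
    Measure.isProbabilityMeasure_map (by fun_prop)
  have hmeas : Measurable fun p : Vec d × Vec d =>
      ENNReal.ofReal (gaussianNormalizer d u * weight u p.1 p.2) :=
    ((measurable_weight_uncurry u).const_mul _).ennreal_ofReal
  ext A hA
  rw [forwardLaw, Measure.map_apply (by fun_prop) hA, Measure.prod_apply
    ((show Measurable fun p : Vec d × Vec d => Real.exp (-u) • p.1 + √(1 - Real.exp (-2 * u)) • p.2
      by fun_prop) hA), withDensity_apply _ hA]
  calc _ = ∫⁻ θ, (∫⁻ y in A, ENNReal.ofReal (gaussianNormalizer d u * weight u y θ)) ∂q0 := by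
        refine lintegral_congr fun θ => ?_
        rw [← withDensity_apply _ hA, ← map_affine_stdGaussian hu θ,
          Measure.map_apply (by fun_prop) hA]
        rfl
    _ = ∫⁻ y in A, ∫⁻ θ, ENNReal.ofReal (gaussianNormalizer d u * weight u y θ) ∂q0 :=
        lintegral_lintegral_swap (hmeas.comp measurable_swap).aemeasurable
    _ = _ := by
        refine lintegral_congr fun y => ?_
        rw [← integral_const_mul, ofReal_integral_eq_lintegral_ofReal
          ((integrable_weight q0 hu y).const_mul _)]
        exact ae_of_all _ fun θ => mul_nonneg (gaussianNormalizer_pos d hu).le (weight_pos u y θ).le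

/-- A continuous density of the forward law is the Gaussian mixture density everywhere. -/
lemma density_eq_integral_weight {d : ℕ} (q0 : Measure (Vec d)) [IsProbabilityMeasure q0] {u : ℝ}
    (hu : 0 < u) {f : Vec d → ℝ} (hf : Continuous f) (hf0 : ∀ y, 0 < f y)
    (h : forwardLaw q0 u = volume.withDensity fun y => ENNReal.ofReal (f y)) (y : Vec d) :
    f y = gaussianNormalizer d u * ∫ θ, weight u y θ ∂q0 := by
  have hg : Continuous fun y => gaussianNormalizer d u * ∫ θ, weight u y θ ∂q0 :=
    (continuous_integral_weight q0 hu).const_mul _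
  rw [forwardLaw_eq_withDensity q0 hu, withDensity_eq_iff_of_sigmaFinite
    hg.measurable.ennreal_ofReal.aemeasurable hf.measurable.ennreal_ofReal.aemeasurable] at h
  have h' : f =ᵐ[volume] fun y => gaussianNormalizer d u * ∫ θ, weight u y θ ∂q0 := by
    filter_upwards [h] with z hz
    refine ((ENNReal.ofReal_eq_ofReal_iff ?_ (hf0 z).le).1 hz).symm
    exact mul_nonneg (gaussianNormalizer_pos d hu).le
      (integral_nonneg fun θ => (weight_pos u z θ).le)
  exact congrFun ((hf.ae_eq_iff_eq volume hg).1 h') y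

section Tilt

variable {E : Type*} [NormedAddCommGroup E]

/-- Continuous real functions of at most polynomial growth. -/
def PolyGrowth (φ : E → ℝ) : Prop :=
  Continuous φ ∧ ∃ (K : ℝ) (n : ℕ), ∀ θ, |φ θ| ≤ K * (1 + ‖θ‖) ^ n

lemma PolyGrowth.const (c : ℝ) : PolyGrowth fun _ : E => c :=
  ⟨continuous_const, |c|, 0, fun θ => by simp⟩

lemma PolyGrowth.mul {φ ψ : E → ℝ} (hφ : PolyGrowth φ) (hψ : PolyGrowth ψ) :
    PolyGrowth fun θ => φ θ * ψ θ := by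
  obtain ⟨hφc, K, n, hK⟩ := hφ
  obtain ⟨hψc, L, m, hL⟩ := hψ
  refine ⟨hφc.mul hψc, K * L, n + m, fun θ => ?_⟩
  rw [abs_mul]
  calc |φ θ| * |ψ θ| ≤ (K * (1 + ‖θ‖) ^ n) * (L * (1 + ‖θ‖) ^ m) :=
        mul_le_mul (hK θ) (hL θ) (abs_nonneg _) ((abs_nonneg _).trans (hK θ))
    _ = K * L * (1 + ‖θ‖) ^ (n + m) := by ring

lemma PolyGrowth.add {φ ψ : E → ℝ} (hφ : PolyGrowth φ) (hψ : PolyGrowth ψ) :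
    PolyGrowth fun θ => φ θ + ψ θ := by
  obtain ⟨hφc, K, n, hK⟩ := hφ
  obtain ⟨hψc, L, m, hL⟩ := hψ
  refine ⟨hφc.add hψc, |K| + |L|, n + m, fun θ => ?_⟩
  have h1 : 1 ≤ 1 + ‖θ‖ := by simp
  calc |φ θ + ψ θ| ≤ |φ θ| + |ψ θ| := abs_add_le _ _
    _ ≤ |K| * (1 + ‖θ‖) ^ (n + m) + |L| * (1 + ‖θ‖) ^ (n + m) := by
        refine add_le_add ((hK θ).trans ?_) ((hL θ).trans ?_)
        · exact mul_le_mul (le_abs_self _) (pow_le_pow_right₀ h1 (by omega)) (by positivity)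
            (abs_nonneg _)
        · exact mul_le_mul (le_abs_self _) (pow_le_pow_right₀ h1 (by omega)) (by positivity)
            (abs_nonneg _)
    _ = (|K| + |L|) * (1 + ‖θ‖) ^ (n + m) := by ring

lemma PolyGrowth.sub {φ ψ : E → ℝ} (hφ : PolyGrowth φ) (hψ : PolyGrowth ψ) :
    PolyGrowth fun θ => φ θ - ψ θ := by
  simpa [sub_eq_add_neg] using hφ.add ((PolyGrowth.const (-1)).mul hψ)

lemma PolyGrowth.norm : PolyGrowth fun θ : E => ‖θ‖ :=
  ⟨continuous_norm, 1, 1, fun θ => by simp⟩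

variable [InnerProductSpace ℝ E]

lemma PolyGrowth.inner (v : E) : PolyGrowth fun θ : E => ⟪v, θ⟫ := by
  refine ⟨by fun_prop, ‖v‖, 1, fun θ => (abs_real_inner_le_norm v θ).trans ?_⟩
  gcongr
  simp

/-- The logarithmic derivative of a Gaussian tilt with velocity `(v, b)`. -/
def tiltScore (v : E) (b : ℝ) (θ : E) : ℝ := ⟪v, θ⟫ - b * ‖θ‖ ^ 2

lemma polyGrowth_tiltScore (v : E) (b : ℝ) : PolyGrowth (tiltScore v b) := by
  have h := (PolyGrowth.inner v).sub ((PolyGrowth.const b).mul (PolyGrowth.norm.mul PolyGrowth.norm))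
  simp only [← sq] at h
  exact h

lemma continuous_tiltScore (v : E) (b : ℝ) : Continuous (tiltScore v b) := by
  unfold tiltScore
  fun_prop

lemma one_add_pow_mul_exp_le (n : ℕ) (V : ℝ) {β : ℝ} (hβ : 0 < β) {y : ℝ} (hy : 0 ≤ y) :
    (1 + y) ^ n * Real.exp (V * y - β * y ^ 2)
      ≤ n.factorial * Real.exp (1 + (V + 1) ^ 2 / (4 * β)) := by
  have h1 : (1 + y) ^ n ≤ n.factorial * Real.exp (1 + y) := by
    have := Real.pow_div_factorial_le_exp (1 + y) (by positivity) n
    rwa [div_le_iff₀' (by positivity)] at this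
  calc (1 + y) ^ n * Real.exp (V * y - β * y ^ 2)
      ≤ n.factorial * Real.exp (1 + y) * Real.exp (V * y - β * y ^ 2) := by gcongr
    _ = n.factorial * Real.exp (1 + y + (V * y - β * y ^ 2)) := by rw [mul_assoc, ← Real.exp_add]
    _ ≤ _ := by
        gcongr ?_ * Real.exp ?_
        have h2 : (V + 1) ^ 2 / (4 * β) - ((V + 1) * y - β * y ^ 2)
            = (V + 1 - 2 * β * y) ^ 2 / (4 * β) := by
          field_simp
          ring
        have h3 : 0 ≤ (V + 1 - 2 * β * y) ^ 2 / (4 * β) := by positivity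
        linarith

/-- Gaussian tilts dominate polynomial growth, locally uniformly in the tilt. -/
lemma PolyGrowth.exists_tilt_bound {φ : E → ℝ} (hφ : PolyGrowth φ) (V : ℝ) {β : ℝ} (hβ : 0 < β) :
    ∃ C, ∀ (v : E) (b : ℝ) (θ : E), ‖v‖ ≤ V → β ≤ b →
      |φ θ| * Real.exp (tiltScore v b θ) ≤ C := by
  obtain ⟨-, K, n, hK⟩ := hφ
  refine ⟨|K| * (n.factorial * Real.exp (1 + (V + 1) ^ 2 / (4 * β))), fun v b θ hv hb => ?_⟩
  have hscore : tiltScore v b θ ≤ V * ‖θ‖ - β * ‖θ‖ ^ 2 := by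
    have h1 : ⟪v, θ⟫ ≤ V * ‖θ‖ := (real_inner_le_norm v θ).trans (by gcongr)
    have h2 : β * ‖θ‖ ^ 2 ≤ b * ‖θ‖ ^ 2 := by gcongr
    unfold tiltScore
    linarith
  calc |φ θ| * Real.exp (tiltScore v b θ)
      ≤ (|K| * (1 + ‖θ‖) ^ n) * Real.exp (V * ‖θ‖ - β * ‖θ‖ ^ 2) := by
        refine mul_le_mul ((hK θ).trans ?_) (Real.exp_le_exp.2 hscore) (Real.exp_pos _).le
          (by positivity)
        gcongr
        exact le_abs_self K
    _ ≤ _ := by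
        rw [mul_assoc]
        refine mul_le_mul_of_nonneg_left ?_ (abs_nonneg K)
        exact one_add_pow_mul_exp_le n V hβ (norm_nonneg θ)

variable [MeasurableSpace E]

/-- The unnormalized Gaussian-tilted integral `∫ φ(θ) exp(⟪v, θ⟫ - b‖θ‖²) dq(θ)`. -/
def tiltIntegral (q : Measure E) (φ : E → ℝ) (v : E) (b : ℝ) : ℝ :=
  ∫ θ, φ θ * Real.exp (tiltScore v b θ) ∂q

/-- The mean of `φ` under the normalized Gaussian tilt of `q`. -/
def tiltMean (q : Measure E) (φ : E → ℝ) (v : E) (b : ℝ) : ℝ :=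
  tiltIntegral q φ v b / tiltIntegral q (fun _ => 1) v b

lemma tiltMean_const_mul (q : Measure E) (c : ℝ) (φ : E → ℝ) (v : E) (b : ℝ) :
    tiltMean q (fun θ => c * φ θ) v b = c * tiltMean q φ v b := by
  simp only [tiltMean, tiltIntegral, mul_assoc, integral_const_mul, mul_div_assoc]

variable [OpensMeasurableSpace E]

lemma PolyGrowth.integrable_tilt (q : Measure E) [IsFiniteMeasure q] {φ : E → ℝ}
    (hφ : PolyGrowth φ) (v : E) {b : ℝ} (hb : 0 < b) :
    Integrable (fun θ => φ θ * Real.exp (tiltScore v b θ)) q := by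
  obtain ⟨C, hC⟩ := hφ.exists_tilt_bound ‖v‖ hb
  refine Integrable.of_bound
    (hφ.1.mul (continuous_tiltScore v b).rexp).aestronglyMeasurable C (ae_of_all _ fun θ => ?_)
  rw [norm_mul, Real.norm_eq_abs, Real.norm_of_nonneg (Real.exp_pos _).le]
  exact hC v b θ le_rfl le_rfl

lemma tiltIntegral_one_pos (q : Measure E) [IsProbabilityMeasure q] (v : E) {b : ℝ} (hb : 0 < b) :
    0 < tiltIntegral q (fun _ => 1) v b := by
  have h := (PolyGrowth.const (E := E) 1).integrable_tilt q v hb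
  simp only [tiltIntegral, one_mul] at h ⊢
  exact integral_exp_pos h

/-- Differentiation of tilted integrals along a continuously differentiable curve of tilts. -/
lemma PolyGrowth.hasDerivAt_tiltIntegral (q : Measure E) [IsFiniteMeasure q] {φ : E → ℝ}
    (hφ : PolyGrowth φ) {v v' : ℝ → E} {b b' : ℝ → ℝ} {r₀ : ℝ}
    (hv : ∀ᶠ r in nhds r₀, HasDerivAt v (v' r) r) (hb : ∀ᶠ r in nhds r₀, HasDerivAt b (b' r) r)
    (hv' : ContinuousAt v' r₀) (hb' : ContinuousAt b' r₀) (hpos : 0 < b r₀) :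
    HasDerivAt (fun r => tiltIntegral q φ (v r) (b r))
      (tiltIntegral q (fun θ => φ θ * tiltScore (v' r₀) (b' r₀) θ) (v r₀) (b r₀)) r₀ := by
  set M := ‖v' r₀‖ + |b' r₀| + 1
  have hψ : PolyGrowth fun θ : E => φ θ * (M * (‖θ‖ + ‖θ‖ * ‖θ‖)) :=
    hφ.mul ((PolyGrowth.const M).mul (PolyGrowth.norm.add (PolyGrowth.norm.mul PolyGrowth.norm)))
  obtain ⟨C, hC⟩ := hψ.exists_tilt_bound (‖v r₀‖ + 1) (half_pos hpos)
  have hvc : ContinuousAt v r₀ := hv.self_of_nhds.continuousAt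
  have hbc : ContinuousAt b r₀ := hb.self_of_nhds.continuousAt
  have hs : {r | HasDerivAt v (v' r) r ∧ HasDerivAt b (b' r) r ∧ ‖v r‖ < ‖v r₀‖ + 1 ∧
      b r₀ / 2 < b r ∧ ‖v' r‖ < M ∧ |b' r| < M} ∈ nhds r₀ := by
    have h1 := hvc.norm.eventually_lt continuousAt_const (lt_add_one ‖v r₀‖)
    have h2 := continuousAt_const.eventually_lt hbc (half_lt_self hpos)
    have h3 := hv'.norm.eventually_lt (continuousAt_const (y := M))
      (by simp only [M]; linarith [abs_nonneg (b' r₀)])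
    have h4 := hb'.abs.eventually_lt (continuousAt_const (y := M))
      (by simp only [M]; linarith [norm_nonneg (v' r₀)])
    filter_upwards [hv, hb, h1, h2, h3, h4] with r a1 a2 a3 a4 a5 a6
    exact ⟨a1, a2, a3, a4, a5, a6⟩
  refine (hasDerivAt_integral_of_dominated_loc_of_deriv_le
    (F := fun r θ => φ θ * Real.exp (tiltScore (v r) (b r) θ))
    (F' := fun r θ => φ θ * tiltScore (v' r) (b' r) θ * Real.exp (tiltScore (v r) (b r) θ))
    (bound := fun _ => C) hs
    (Filter.Eventually.of_forall fun r =>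
      (hφ.1.mul (continuous_tiltScore (v r) (b r)).rexp).aestronglyMeasurable)
    (hφ.integrable_tilt q (v r₀) hpos)
    ((hφ.1.mul (continuous_tiltScore _ _)).mul (continuous_tiltScore _ _).rexp).aestronglyMeasurable
    (ae_of_all _ fun θ r hr => ?_) (integrable_const _) (ae_of_all _ fun θ r hr => ?_)).2
  · obtain ⟨-, -, hr1, hr2, hr3, hr4⟩ := hr
    refine le_trans ?_ (hC (v r) (b r) θ hr1.le hr2.le)
    rw [norm_mul, norm_mul, Real.norm_of_nonneg (Real.exp_pos _).le, Real.norm_eq_abs,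
      Real.norm_eq_abs, abs_mul]
    refine mul_le_mul_of_nonneg_right (mul_le_mul_of_nonneg_left ?_ (abs_nonneg _))
      (Real.exp_pos _).le
    refine le_trans ?_ (le_abs_self _)
    calc |tiltScore (v' r) (b' r) θ| ≤ |⟪v' r, θ⟫| + |b' r * ‖θ‖ ^ 2| := abs_sub _ _
      _ ≤ M * ‖θ‖ + M * ‖θ‖ ^ 2 := by
          refine add_le_add ((abs_real_inner_le_norm _ _).trans (by gcongr)) ?_
          rw [abs_mul, abs_of_nonneg (sq_nonneg ‖θ‖)]
          gcongr
      _ = _ := by ring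
  · have h1 : HasDerivAt (fun r => tiltScore (v r) (b r) θ) (tiltScore (v' r) (b' r) θ) r := by
      have := (hr.1.inner ℝ (hasDerivAt_const r θ)).sub (hr.2.1.mul_const (‖θ‖ ^ 2))
      simp only [inner_zero_right, zero_add] at this
      exact this
    exact (h1.exp.const_mul (φ θ)).congr_deriv (by ring)

/-- Along a curve of tilts, the derivative of a tilted mean is a covariance with the score. -/
lemma PolyGrowth.hasDerivAt_tiltMean (q : Measure E) [IsProbabilityMeasure q] {φ : E → ℝ}
    (hφ : PolyGrowth φ) {v v' : ℝ → E} {b b' : ℝ → ℝ} {r₀ : ℝ}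
    (hv : ∀ᶠ r in nhds r₀, HasDerivAt v (v' r) r) (hb : ∀ᶠ r in nhds r₀, HasDerivAt b (b' r) r)
    (hv' : ContinuousAt v' r₀) (hb' : ContinuousAt b' r₀) (hpos : 0 < b r₀) :
    HasDerivAt (fun r => tiltMean q φ (v r) (b r))
      (tiltMean q (fun θ => φ θ * tiltScore (v' r₀) (b' r₀) θ) (v r₀) (b r₀)
        - tiltMean q φ (v r₀) (b r₀)
          * tiltMean q (tiltScore (v' r₀) (b' r₀)) (v r₀) (b r₀)) r₀ := by
  have hZ := tiltIntegral_one_pos q (v r₀) hpos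
  have h1 := (PolyGrowth.const (E := E) 1).hasDerivAt_tiltIntegral q hv hb hv' hb' hpos
  simp only [one_mul] at h1
  refine ((hφ.hasDerivAt_tiltIntegral q hv hb hv' hb' hpos).div h1 hZ.ne').congr_deriv ?_
  simp only [tiltMean]
  field_simp

lemma hasDerivAt_log_tiltIntegral_one (q : Measure E) [IsProbabilityMeasure q]
    {v v' : ℝ → E} {b b' : ℝ → ℝ} {r₀ : ℝ}
    (hv : ∀ᶠ r in nhds r₀, HasDerivAt v (v' r) r) (hb : ∀ᶠ r in nhds r₀, HasDerivAt b (b' r) r)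
    (hv' : ContinuousAt v' r₀) (hb' : ContinuousAt b' r₀) (hpos : 0 < b r₀) :
    HasDerivAt (fun r => Real.log (tiltIntegral q (fun _ => 1) (v r) (b r)))
      (tiltMean q (tiltScore (v' r₀) (b' r₀)) (v r₀) (b r₀)) r₀ := by
  have hZ := tiltIntegral_one_pos q (v r₀) hpos
  have h1 := (PolyGrowth.const (E := E) 1).hasDerivAt_tiltIntegral q hv hb hv' hb' hpos
  simp only [one_mul] at h1
  exact h1.log hZ.ne'

end Tilt

section Covariance

variable {Ω : Type*} [MeasurableSpace Ω] {μ : Measure Ω} [IsProbabilityMeasure μ] {A B F : Ω → ℝ}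

lemma integral_centered_mul_centered (hA : Integrable A μ) (hB : Integrable B μ)
    (hAB : Integrable (fun ω => A ω * B ω) μ) :
    ∫ ω, (A ω - ∫ ω, A ω ∂μ) * (B ω - ∫ ω, B ω ∂μ) ∂μ
      = ∫ ω, A ω * B ω ∂μ - (∫ ω, A ω ∂μ) * ∫ ω, B ω ∂μ := by
  set a := ∫ ω, A ω ∂μ with ha
  set b := ∫ ω, B ω ∂μ with hb
  have h (ω : Ω) : (A ω - a) * (B ω - b) = A ω * B ω - b * A ω - a * B ω + a * b := by ring
  simp only [h]
  have h1 : Integrable (fun ω => A ω * B ω - b * A ω) μ := hAB.sub (hA.const_mul b)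
  have h2 : Integrable (fun ω => A ω * B ω - b * A ω - a * B ω) μ := h1.sub (hB.const_mul a)
  rw [integral_add h2 (integrable_const _), integral_sub h1 (hB.const_mul a),
    integral_sub hAB (hA.const_mul b),
    integral_const_mul, integral_const_mul, integral_const, ← ha, ← hb, probReal_univ, one_smul]
  ring

lemma integral_centered_mul_centered_mul_centered (hA : Integrable A μ) (hB : Integrable B μ)
    (hF : Integrable F μ) (hAB : Integrable (fun ω => A ω * B ω) μ)
    (hAF : Integrable (fun ω => A ω * F ω) μ) (hBF : Integrable (fun ω => B ω * F ω) μ)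
    (hABF : Integrable (fun ω => A ω * B ω * F ω) μ) :
    ∫ ω, (A ω - ∫ ω, A ω ∂μ) * (B ω - ∫ ω, B ω ∂μ) * (F ω - ∫ ω, F ω ∂μ) ∂μ
      = ∫ ω, A ω * B ω * F ω ∂μ - (∫ ω, A ω * B ω ∂μ) * ∫ ω, F ω ∂μ
        - ((∫ ω, A ω * F ω ∂μ - (∫ ω, A ω ∂μ) * ∫ ω, F ω ∂μ) * ∫ ω, B ω ∂μ
          + (∫ ω, A ω ∂μ) * (∫ ω, B ω * F ω ∂μ - (∫ ω, B ω ∂μ) * ∫ ω, F ω ∂μ)) := by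
  have hc := integral_centered_mul_centered hA hB hAB
  set a := ∫ ω, A ω ∂μ
  set b := ∫ ω, B ω ∂μ
  set f := ∫ ω, F ω ∂μ with hf
  have h (ω : Ω) : (A ω - a) * (B ω - b) * (F ω - f)
      = A ω * B ω * F ω - b * (A ω * F ω) - a * (B ω * F ω) + a * b * F ω
        - f * ((A ω - a) * (B ω - b)) := by ring
  have hcent : Integrable (fun ω => (A ω - a) * (B ω - b)) μ := by
    have := ((hAB.sub (hA.const_mul b)).sub (hB.const_mul a)).add (integrable_const (a * b))
    refine this.congr (ae_of_all _ fun ω => ?_)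
    simp only [Pi.add_apply, Pi.sub_apply]
    ring
  have h1 : Integrable (fun ω => A ω * B ω * F ω - b * (A ω * F ω)) μ :=
    hABF.sub (hAF.const_mul b)
  have h2 : Integrable (fun ω => A ω * B ω * F ω - b * (A ω * F ω) - a * (B ω * F ω)) μ :=
    h1.sub (hBF.const_mul a)
  have h3 : Integrable
      (fun ω => A ω * B ω * F ω - b * (A ω * F ω) - a * (B ω * F ω) + a * b * F ω) μ :=
    h2.add (hF.const_mul (a * b))
  simp only [h]
  rw [integral_sub h3 (hcent.const_mul f), integral_add h2 (hF.const_mul (a * b)),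
    integral_sub h1 (hBF.const_mul a), integral_sub hABF (hAF.const_mul b), integral_const_mul,
    integral_const_mul, integral_const_mul, integral_const_mul, hc, ← hf]
  ring

end Covariance

/-- The coefficient `λ_u / σ_u²` of `⟪x, θ⟫` in the exponent of the Gaussian weight. -/
def tiltSlope (u : ℝ) : ℝ := Real.exp (-u) / (1 - Real.exp (-2 * u))

/-- The coefficient `λ_u² / (2σ_u²)` of `-‖θ‖²` in the exponent of the Gaussian weight. -/
def tiltRate (u : ℝ) : ℝ := Real.exp (-u) ^ 2 / (2 * (1 - Real.exp (-2 * u)))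

lemma tiltRate_pos {u : ℝ} (hu : 0 < u) : 0 < tiltRate u := by
  have := one_sub_exp_pos hu
  unfold tiltRate
  positivity

lemma weight_eq_mul_exp_tiltScore {d : ℕ} {u : ℝ} (hu : 0 < u) (y θ : Vec d) :
    weight u y θ = Real.exp (-‖y‖ ^ 2 / (2 * (1 - Real.exp (-2 * u))))
      * Real.exp (tiltScore (tiltSlope u • y) (tiltRate u) θ) := by
  have hs := (one_sub_exp_pos hu).ne'
  rw [weight, ← Real.exp_add, tiltScore, tiltSlope, tiltRate, norm_sub_sq_real,
    real_inner_smul_left, real_inner_smul_right, norm_smul, Real.norm_of_nonneg (Real.exp_pos _).le]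
  congr 1
  field_simp
  ring

lemma integral_mul_weight {d : ℕ} (q0 : Measure (Vec d)) {u : ℝ} (hu : 0 < u) (y : Vec d)
    (φ : Vec d → ℝ) :
    ∫ θ, φ θ * weight u y θ ∂q0 = Real.exp (-‖y‖ ^ 2 / (2 * (1 - Real.exp (-2 * u))))
      * tiltIntegral q0 φ (tiltSlope u • y) (tiltRate u) := by
  rw [tiltIntegral, ← integral_const_mul]
  refine integral_congr_ae (ae_of_all _ fun θ => ?_)
  simp only [weight_eq_mul_exp_tiltScore hu]
  ring

lemma integral_weight_pos {d : ℕ} (q0 : Measure (Vec d)) [IsProbabilityMeasure q0] {u : ℝ}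
    (hu : 0 < u) (y : Vec d) : 0 < ∫ θ, weight u y θ ∂q0 := by
  have h := integral_mul_weight q0 hu y fun _ => 1
  simp only [one_mul] at h
  rw [h]
  exact mul_pos (Real.exp_pos _) (tiltIntegral_one_pos q0 _ (tiltRate_pos hu))

lemma lintegral_weight {d : ℕ} (q0 : Measure (Vec d)) [IsProbabilityMeasure q0] {u : ℝ}
    (hu : 0 < u) (y : Vec d) :
    ∫⁻ θ, ENNReal.ofReal (weight u y θ) ∂q0 = ENNReal.ofReal (∫ θ, weight u y θ ∂q0) :=
  (ofReal_integral_eq_lintegral_ofReal (integrable_weight q0 hu y)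
    (ae_of_all _ fun θ => (weight_pos u y θ).le)).symm

lemma isProbabilityMeasure_condMeasure {d : ℕ} (q0 : Measure (Vec d)) [IsProbabilityMeasure q0]
    {u : ℝ} (hu : 0 < u) (y : Vec d) : IsProbabilityMeasure (condMeasure q0 u y) := by
  refine ⟨?_⟩
  rw [condMeasure, Measure.smul_apply, withDensity_apply _ MeasurableSet.univ, setLIntegral_univ,
    smul_eq_mul]
  refine ENNReal.inv_mul_cancel ?_ ?_ <;> rw [lintegral_weight q0 hu]
  · simpa using integral_weight_pos q0 hu y
  · exact ENNReal.ofReal_ne_top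

lemma PolyGrowth.integrable_condMeasure {d : ℕ} (q0 : Measure (Vec d)) [IsProbabilityMeasure q0]
    {u : ℝ} (hu : 0 < u) (y : Vec d) {φ : Vec d → ℝ} (hφ : PolyGrowth φ) :
    Integrable φ (condMeasure q0 u y) := by
  have hm : Measurable fun θ => ENNReal.ofReal (weight u y θ) :=
    (continuous_weight_right u y).measurable.ennreal_ofReal
  refine Integrable.smul_measure ?_ ?_
  · rw [integrable_withDensity_iff hm (ae_of_all _ fun θ => ENNReal.ofReal_lt_top)]
    have := (hφ.integrable_tilt q0 (tiltSlope u • y) (tiltRate_pos hu)).const_mul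
      (Real.exp (-‖y‖ ^ 2 / (2 * (1 - Real.exp (-2 * u)))))
    refine this.congr (ae_of_all _ fun θ => ?_)
    simp only [ENNReal.toReal_ofReal (weight_pos u y θ).le]
    rw [weight_eq_mul_exp_tiltScore hu]
    ring
  · rw [lintegral_weight q0 hu]
    simpa using integral_weight_pos q0 hu y

lemma integral_condMeasure {d : ℕ} (q0 : Measure (Vec d)) [IsProbabilityMeasure q0] {u : ℝ}
    (hu : 0 < u) (y : Vec d) (φ : Vec d → ℝ) :
    ∫ θ, φ θ ∂(condMeasure q0 u y) = tiltMean q0 φ (tiltSlope u • y) (tiltRate u) := by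
  have hm : Measurable fun θ => ENNReal.ofReal (weight u y θ) :=
    (continuous_weight_right u y).measurable.ennreal_ofReal
  have h1 := integral_mul_weight q0 hu y fun _ => 1
  simp only [one_mul] at h1
  rw [condMeasure, integral_smul_measure, lintegral_weight q0 hu,
    integral_withDensity_eq_integral_toReal_smul hm
      (ae_of_all _ fun θ => ENNReal.ofReal_lt_top), ENNReal.toReal_inv,
    ENNReal.toReal_ofReal (integral_weight_pos q0 hu y).le, h1]
  simp only [ENNReal.toReal_ofReal (weight_pos u y _).le, smul_eq_mul, mul_comm (weight u y _)]
  rw [integral_mul_weight q0 hu, tiltMean]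
  have := (tiltIntegral_one_pos q0 (tiltSlope u • y) (tiltRate_pos hu)).ne'
  field_simp

lemma polyGrowth_apply {d : ℕ} (i : Fin d) : PolyGrowth fun θ : Vec d => θ i := by
  simpa [EuclideanSpace.inner_single_left] using
    PolyGrowth.inner (EuclideanSpace.single i (1 : ℝ))

lemma condMean_apply {d : ℕ} (q0 : Measure (Vec d)) [IsProbabilityMeasure q0] {u : ℝ}
    (hu : 0 < u) (y : Vec d) (i : Fin d) :
    condMean q0 u y i = ∫ θ, θ i ∂(condMeasure q0 u y) :=
  (eval_integral_piLp fun j => (polyGrowth_apply j).integrable_condMeasure q0 hu y) i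

lemma pd_eq_of_hasDerivAt {d : ℕ} {i : Fin d} {f : Vec d → ℝ} {y : Vec d} {f' : ℝ}
    (hf : DifferentiableAt ℝ f y)
    (h : HasDerivAt (fun r : ℝ => f (y + r • EuclideanSpace.single i 1)) f' 0) :
    pd i f y = f' := by
  rw [pd, ← hf.lineDeriv_eq_fderiv, lineDeriv, h.deriv]

lemma contDiff_pd {d : ℕ} {i : Fin d} {f : Vec d → ℝ} (hf : ContDiff ℝ (⊤ : ℕ∞) f) :
    ContDiff ℝ (⊤ : ℕ∞) (pd i f) :=
  (hf.fderiv_right (m := (⊤ : ℕ∞)) (by simp)).clm_apply contDiff_const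

/-- The tilt along a coordinate line moves at constant velocity. -/
lemma hasDerivAt_smul_line {d : ℕ} (a : ℝ) (y e : Vec d) (r : ℝ) :
    HasDerivAt (fun r : ℝ => a • (y + r • e)) (a • e) r := by
  exact ((((hasDerivAt_id r).smul_const e).const_add y).const_smul a).congr_deriv (by simp)

lemma tiltScore_smul_single {d : ℕ} (a : ℝ) (i : Fin d) (θ : Vec d) :
    tiltScore (a • EuclideanSpace.single i (1 : ℝ)) 0 θ = a * θ i := by
  simp [tiltScore, real_inner_smul_left, EuclideanSpace.inner_single_left]

section Density

variable {d : ℕ} (q0 : Measure (Vec d)) [IsProbabilityMeasure q0] {u : ℝ} {f : Vec d → ℝ}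

lemma log_density_eq (hu : 0 < u) (hf : Continuous f) (hf0 : ∀ y, 0 < f y)
    (h : forwardLaw q0 u = volume.withDensity fun y => ENNReal.ofReal (f y)) (y : Vec d) :
    Real.log (f y) = Real.log (gaussianNormalizer d u)
      + (-‖y‖ ^ 2 / (2 * (1 - Real.exp (-2 * u)))
        + Real.log (tiltIntegral q0 (fun _ => 1) (tiltSlope u • y) (tiltRate u))) := by
  have h1 := integral_mul_weight q0 hu y fun _ => 1
  simp only [one_mul] at h1
  have hZ := tiltIntegral_one_pos q0 (tiltSlope u • y) (tiltRate_pos hu)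
  rw [density_eq_integral_weight q0 hu hf hf0 h, h1,
    Real.log_mul (gaussianNormalizer_pos d hu).ne' (by positivity),
    Real.log_mul (Real.exp_pos _).ne' hZ.ne', Real.log_exp]

lemma pd_log_density (hu : 0 < u) (hf : ContDiff ℝ (⊤ : ℕ∞) f) (hf0 : ∀ y, 0 < f y)
    (h : forwardLaw q0 u = volume.withDensity fun y => ENNReal.ofReal (f y)) (j : Fin d)
    (y : Vec d) :
    pd j (fun y => Real.log (f y)) y = -y j / (1 - Real.exp (-2 * u))
      + tiltSlope u * tiltMean q0 (fun θ => θ j) (tiltSlope u • y) (tiltRate u) := by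
  have hs := (one_sub_exp_pos hu).ne'
  refine pd_eq_of_hasDerivAt
    ((hf.log fun y => (hf0 y).ne').differentiable (by simp)).differentiableAt ?_
  simp only [log_density_eq q0 hu hf.continuous hf0 h]
  have hlog := hasDerivAt_log_tiltIntegral_one q0
    (.of_forall (hasDerivAt_smul_line (tiltSlope u) y (EuclideanSpace.single j 1)))
    (.of_forall fun r => hasDerivAt_const r (tiltRate u)) continuousAt_const continuousAt_const
    (tiltRate_pos hu) (r₀ := 0)
  simp only [funext (tiltScore_smul_single (tiltSlope u) j), tiltMean_const_mul, zero_smul,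
    add_zero] at hlog
  have hline : HasDerivAt (fun r : ℝ => y + r • EuclideanSpace.single j (1 : ℝ))
      (EuclideanSpace.single j 1) 0 := by
    simpa using hasDerivAt_smul_line 1 y (EuclideanSpace.single j 1) 0
  have hnorm := (hline.norm_sq.neg.div_const (2 * (1 - Real.exp (-2 * u)))).add hlog
  refine (hnorm.const_add (Real.log (gaussianNormalizer d u))).congr_deriv ?_
  simp [EuclideanSpace.inner_single_right]
  field_simp

lemma pd_pd_log_density (hu : 0 < u) (hf : ContDiff ℝ (⊤ : ℕ∞) f) (hf0 : ∀ y, 0 < f y)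
    (h : forwardLaw q0 u = volume.withDensity fun y => ENNReal.ofReal (f y)) (i j : Fin d)
    (x : Vec d) :
    pd i (pd j fun y => Real.log (f y)) x
      = -(1 / (1 - Real.exp (-2 * u))) * (if i = j then 1 else 0)
        + tiltSlope u ^ 2 * (tiltMean q0 (fun θ => θ i * θ j) (tiltSlope u • x) (tiltRate u)
          - tiltMean q0 (fun θ => θ i) (tiltSlope u • x) (tiltRate u)
            * tiltMean q0 (fun θ => θ j) (tiltSlope u • x) (tiltRate u)) := by
  refine pd_eq_of_hasDerivAt
    ((contDiff_pd (hf.log fun y => (hf0 y).ne')).differentiable (by simp)).differentiableAt ?_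
  simp only [pd_log_density q0 hu hf hf0 h]
  have hmean := (polyGrowth_apply j).hasDerivAt_tiltMean q0
    (.of_forall (hasDerivAt_smul_line (tiltSlope u) x (EuclideanSpace.single i 1)))
    (.of_forall fun r => hasDerivAt_const r (tiltRate u)) continuousAt_const continuousAt_const
    (tiltRate_pos hu) (r₀ := 0)
  have hcomm : (fun θ : Vec d => θ j * (tiltSlope u * θ i))
      = fun θ => tiltSlope u * (θ i * θ j) := by
    funext θ
    ring
  simp only [funext (tiltScore_smul_single (tiltSlope u) i), hcomm, tiltMean_const_mul, zero_smul,
    add_zero] at hmean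
  have hcoord : HasDerivAt (fun r : ℝ => (x + r • EuclideanSpace.single i (1 : ℝ)) j)
      (if i = j then 1 else 0) 0 := by
    have := ((hasDerivAt_id (0 : ℝ)).mul_const (if i = j then (1 : ℝ) else 0)).const_add (x j)
    simpa [PiLp.single_apply, eq_comm] using this
  refine ((hcoord.neg.div_const _).add (hmean.const_mul (tiltSlope u))).congr_deriv ?_
  ring

end Density

lemma hasDerivAt_one_sub_exp (u : ℝ) :
    HasDerivAt (fun u => 1 - Real.exp (-2 * u)) (2 * Real.exp (-u) ^ 2) u := by
  refine (((hasDerivAt_id u).const_mul (-2)).exp.const_sub 1).congr_deriv ?_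
  rw [← Real.exp_nat_mul]
  simp
  ring_nf

lemma hasDerivAt_exp_neg (u : ℝ) : HasDerivAt (fun u => Real.exp (-u)) (-Real.exp (-u)) u := by
  simpa using (hasDerivAt_id u).neg.exp

lemma one_sub_exp_eq (u : ℝ) : 1 - Real.exp (-2 * u) = 1 - Real.exp (-u) ^ 2 := by
  rw [← Real.exp_nat_mul]
  simp

lemma hasDerivAt_tiltSlope {u : ℝ} (hu : 0 < u) :
    HasDerivAt tiltSlope
      (-((Real.exp (-u) + Real.exp (-u) ^ 3) / (1 - Real.exp (-2 * u)) ^ 2)) u := by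
  have hs := (one_sub_exp_pos hu).ne'
  refine ((hasDerivAt_exp_neg u).div (hasDerivAt_one_sub_exp u) hs).congr_deriv ?_
  rw [← neg_div]
  congr 1
  rw [one_sub_exp_eq]
  ring

lemma hasDerivAt_tiltRate {u : ℝ} (hu : 0 < u) :
    HasDerivAt tiltRate (-(Real.exp (-u) ^ 2 / (1 - Real.exp (-2 * u)) ^ 2)) u := by
  have hs := (one_sub_exp_pos hu).ne'
  refine (((hasDerivAt_exp_neg u).pow 2).div ((hasDerivAt_one_sub_exp u).const_mul 2)
    (mul_ne_zero two_ne_zero hs)).congr_deriv ?_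
  rw [one_sub_exp_eq] at hs ⊢
  simp only [Pi.pow_apply]
  field_simp
  ring

/-- **Lemma (time derivative of the Hessian of the log-density).** If `q0` has finite fourth
moment then for `t > 0` and `x ∈ ℝ^d`,
`∂_t ∇_x² log q_t(x) = (2λ_t²/σ_t⁴) I_d + (2λ_t²/σ_t⁴ - 4λ_t²/σ_t⁶) C_t(x)
  + (λ_t²/σ_t⁴) E_{t,x}[(θ-m)(θ-m)ᵀ (f₀ - E_{t,x} f₀)]`, stated entrywise. -/
theorem partial_t_hessian_log_density
    {d : ℕ} (hd : 1 ≤ d) (q0 : Measure (Vec d)) [IsProbabilityMeasure q0]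
    (ρ : ℝ → Vec d → ℝ)
    (hρ : ∀ u, 0 < u → forwardLaw q0 u = volume.withDensity fun x => ENNReal.ofReal (ρ u x))
    (hρpos : ∀ u, 0 < u → ∀ x, 0 < ρ u x)
    (hρsmooth : ∀ u, 0 < u → ContDiff ℝ (⊤ : ℕ∞) (ρ u))
    (hmom : Integrable (fun θ => ‖θ‖^4) q0)
    (t : ℝ) (ht : 0 < t) (x : Vec d) (i j : Fin d) :
    HasDerivAt (fun u => pd i (pd j (fun y => Real.log (ρ u y))) x)
      ((2 * Real.exp (-t)^2 / (1 - Real.exp (-2*t))^2) * (if i = j then 1 else 0)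
        + (2 * Real.exp (-t)^2 / (1 - Real.exp (-2*t))^2
            - 4 * Real.exp (-t)^2 / (1 - Real.exp (-2*t))^3)
          * ∫ θ, (θ i - condMean q0 t x i) * (θ j - condMean q0 t x j) ∂(condMeasure q0 t x)
        + (Real.exp (-t)^2 / (1 - Real.exp (-2*t))^2)
          * ∫ θ, (θ i - condMean q0 t x i) * (θ j - condMean q0 t x j)
              * (f0 t x θ - ∫ θ', f0 t x θ' ∂(condMeasure q0 t x))
              ∂(condMeasure q0 t x)) t := by
  have hs := one_sub_exp_pos ht
  have hprob := isProbabilityMeasure_condMeasure q0 ht x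
  set v' : ℝ → Vec d := fun u =>
    (-((Real.exp (-u) + Real.exp (-u) ^ 3) / (1 - Real.exp (-2 * u)) ^ 2)) • x with hv'
  set b' : ℝ → ℝ := fun u => -(Real.exp (-u) ^ 2 / (1 - Real.exp (-2 * u)) ^ 2) with hb'
  have hpos : ∀ᶠ u in nhds t, 0 < u := lt_mem_nhds ht
  have hv : ∀ᶠ u in nhds t, HasDerivAt (fun u => tiltSlope u • x) (v' u) u :=
    hpos.mono fun u hu => (hasDerivAt_tiltSlope hu).smul_const x
  have hb : ∀ᶠ u in nhds t, HasDerivAt tiltRate (b' u) u :=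
    hpos.mono fun u hu => hasDerivAt_tiltRate hu
  have hne : (1 - Real.exp (-2 * t)) ^ 2 ≠ 0 := by positivity
  have hv'c : ContinuousAt v' t := by fun_prop (disch := exact hne)
  have hb'c : ContinuousAt b' t := by fun_prop (disch := exact hne)
  have hscore : tiltScore (v' t) (b' t) = f0 t x := by
    funext θ
    simp only [tiltScore, f0, hv', hb', real_inner_smul_left]
    ring
  have hi := polyGrowth_apply i
  have hj := polyGrowth_apply j
  have hf : PolyGrowth (f0 t x) := hscore ▸ polyGrowth_tiltScore _ _
  have hmean {φ : Vec d → ℝ} (hφ : PolyGrowth φ) :=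
    hφ.hasDerivAt_tiltMean q0 hv hb hv'c hb'c (tiltRate_pos ht)
  simp only [hscore, ← integral_condMeasure q0 ht] at hmean
  have hint {φ : Vec d → ℝ} (hφ : PolyGrowth φ) : Integrable φ (condMeasure q0 t x) :=
    hφ.integrable_condMeasure q0 ht x
  simp only [condMean_apply q0 ht]
  rw [integral_centered_mul_centered (hint hi) (hint hj) (hint (hi.mul hj)),
    integral_centered_mul_centered_mul_centered (hint hi) (hint hj) (hint hf) (hint (hi.mul hj))
      (hint (hi.mul hf)) (hint (hj.mul hf)) (hint ((hi.mul hj).mul hf))]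
  have hcov := (hmean (hi.mul hj)).sub ((hmean hi).mul (hmean hj))
  have hdiag := (((hasDerivAt_one_sub_exp t).inv hs.ne').neg).mul_const
    (if i = j then (1 : ℝ) else 0)
  have hmain := hdiag.add (((hasDerivAt_tiltSlope ht).pow 2).mul hcov)
  refine (hmain.congr_of_eventuallyEq ?_).congr_deriv ?_
  · filter_upwards [hpos] with u hu
    rw [pd_pd_log_density q0 hu (hρsmooth u hu) (hρpos u hu) (hρ u hu)]
    simp
  · simp only [Pi.sub_apply, Pi.mul_apply, Pi.pow_apply, ← integral_condMeasure q0 ht]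
    simp only [tiltSlope, Nat.reduceSub, pow_one, Nat.cast_ofNat]
    rw [one_sub_exp_eq] at hs ⊢
    field_simp
    ring

end
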